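/- arXiv:1708.03354 — 3 statements merged into one kernel-verified Lean document; each statement's English description precedes it below -/
import Mathlib

section
/- Let r ≥ 0 and s ≥ 1 be integers with w = r + s > 0 even. Then ∂_r 𝓔_{r,s} = (r+1)·𝓔_{r+1,s−1} as functions on ℍ. -/
open Complex

/-- The holomorphic Wirtinger derivative `∂/∂z = ½(∂/∂x − i ∂/∂y)`. -/
noncomputable def wderiv (f : ℂ → ℂ) (z : ℂ) : ℂ :=
  (1 / 2) * (fderiv ℝ f z 1 - Complex.I * fderiv ℝ f z Complex.I)

/-- The Maass-type raising operator `(∂_r f)(z) = (z − z̄)·(∂f/∂z)(z) + r·f(z)`. -/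
noncomputable def dOp (r : ℤ) (f : ℂ → ℂ) (z : ℂ) : ℂ :=
  (z - (starRingEnd ℂ) z) * wderiv f z + (r : ℂ) * f z

/-- `𝕃(z) = πi(z − z̄) = −2π·Im z`. -/
noncomputable def Lfun (z : ℂ) : ℂ := (Real.pi : ℂ) * Complex.I * (z - (starRingEnd ℂ) z)

/-- The summand `(mz+n)^{−(r+1)}·(mz̄+n)^{−(s+1)}` of the real analytic Eisenstein series. -/
noncomputable def eisSummand (r s : ℕ) (z : ℂ) (p : ℤ × ℤ) : ℂ :=
  ((p.1 : ℂ) * z + (p.2 : ℂ)) ^ (-((r : ℤ) + 1)) *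
    ((p.1 : ℂ) * (starRingEnd ℂ) z + (p.2 : ℂ)) ^ (-((s : ℤ) + 1))

/-- The real analytic Eisenstein series
`𝓔_{r,s}(z) = (w!/(2πi)^{w+2})·(1/2)·𝕃(z)·Σ'_{(m,n)} (mz+n)^{−(r+1)}(mz̄+n)^{−(s+1)}`. -/
noncomputable def Eis (r s : ℕ) (z : ℂ) : ℂ :=
  ((r + s).factorial : ℂ) / (2 * (Real.pi : ℂ) * Complex.I) ^ (r + s + 2) * (1 / 2) *
    Lfun z * ∑' p : {p : ℤ × ℤ // p ≠ 0}, eisSummand r s z p.1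

/-- The real-linear map `v ↦ α v + β v̄`, i.e. `α dz + β dz̄`. -/
noncomputable def wirtingerCLM (α β : ℂ) : ℂ →L[ℝ] ℂ :=
  α • (1 : ℂ →L[ℝ] ℂ) + β • (conjCLE : ℂ →L[ℝ] ℂ)

lemma wirtingerCLM_apply (α β v : ℂ) :
    wirtingerCLM α β v = α * v + β * (starRingEnd ℂ) v := by
  simp [wirtingerCLM]

lemma smul_wirtingerCLM (c α β : ℂ) :
    c • wirtingerCLM α β = wirtingerCLM (c * α) (c * β) := by
  simp only [wirtingerCLM, smul_add, smul_smul]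

lemma norm_wirtingerCLM_le (α β : ℂ) : ‖wirtingerCLM α β‖ ≤ ‖α‖ + ‖β‖ := by
  refine ContinuousLinearMap.opNorm_le_bound _ (by positivity) fun v ↦ ?_
  rw [wirtingerCLM_apply, add_mul]
  exact (norm_add_le _ _).trans_eq (by simp)

lemma HasFDerivAt.wderiv_eq {f : ℂ → ℂ} {z α β : ℂ}
    (h : HasFDerivAt f (wirtingerCLM α β) z) : wderiv f z = α := by
  rw [wderiv, h.fderiv, wirtingerCLM_apply, wirtingerCLM_apply]
  simp only [map_one, conj_I]
  linear_combination (β / 2 - α / 2) * I_sq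

lemma HasFDerivAt.mul_wirtingerCLM {f g : ℂ → ℂ} {z α β γ δ : ℂ}
    (hf : HasFDerivAt f (wirtingerCLM α β) z) (hg : HasFDerivAt g (wirtingerCLM γ δ) z) :
    HasFDerivAt (fun w ↦ f w * g w)
      (wirtingerCLM (α * g z + f z * γ) (β * g z + f z * δ)) z := by
  refine (hf.mul hg).congr_fderiv ?_
  ext v
  all_goals
    simp only [wirtingerCLM_apply, add_apply, smul_apply,
      smul_eq_mul]
    ring

lemma HasDerivAt.hasFDerivAt_wirtingerCLM {f : ℂ → ℂ} {f' z : ℂ} (h : HasDerivAt f f' z) :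
    HasFDerivAt f (wirtingerCLM f' 0) z :=
  h.complexToReal_fderiv.congr_fderiv (by simp [wirtingerCLM])

lemma HasDerivAt.hasFDerivAt_comp_conj {f : ℂ → ℂ} {f' z : ℂ}
    (h : HasDerivAt f f' ((starRingEnd ℂ) z)) :
    HasFDerivAt (fun w ↦ f ((starRingEnd ℂ) w)) (wirtingerCLM 0 f') z := by
  have := HasFDerivAt.comp z (g := f) (f := conjCLE) h.complexToReal_fderiv
    conjCLE.hasFDerivAt
  refine this.congr_fderiv ?_
  ext v
  all_goals simp [wirtingerCLM]

lemma hasFDerivAt_Lfun (z : ℂ) :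
    HasFDerivAt Lfun (wirtingerCLM (Real.pi * I) (-(Real.pi * I))) z := by
  have h := ((1 : ℂ →L[ℝ] ℂ).hasFDerivAt (x := z)).sub
    ((conjCLE : ℂ →L[ℝ] ℂ).hasFDerivAt (x := z))
  refine (h.const_mul ((Real.pi : ℂ) * I)).congr_fderiv ?_
  ext v
  all_goals
    simp [wirtingerCLM, sub_eq_add_neg]

lemma hasDerivAt_linear_zpow (m n z : ℂ) (k : ℤ) (h : m * z + n ≠ 0) :
    HasDerivAt (fun w ↦ (m * w + n) ^ k) (k * m * (m * z + n) ^ (k - 1)) z := by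
  have h₁ : HasDerivAt (fun w ↦ m * w + n) m z := by
    simpa using ((hasDerivAt_id z).const_mul m).add_const n
  have h₂ := (hasDerivAt_zpow k (m * z + n) (Or.inl h)).comp z h₁
  rwa [mul_right_comm] at h₂

lemma hasFDerivAt_eisSummand (r s : ℕ) {z : ℂ} {p : ℤ × ℤ} (h : (p.1 : ℂ) * z + p.2 ≠ 0)
    (h' : (p.1 : ℂ) * (starRingEnd ℂ) z + p.2 ≠ 0) :
    HasFDerivAt (fun w ↦ eisSummand r s w p)
      (wirtingerCLM (-((r : ℂ) + 1) * p.1 * eisSummand (r + 1) s z p)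
        (-((s : ℂ) + 1) * p.1 * eisSummand r (s + 1) z p)) z := by
  have hr := (hasDerivAt_linear_zpow _ _ _ (-((r : ℤ) + 1)) h).hasFDerivAt_wirtingerCLM
  have hs := (hasDerivAt_linear_zpow _ _ _ (-((s : ℤ) + 1)) h').hasFDerivAt_comp_conj
  refine (hr.mul_wirtingerCLM hs).congr_fderiv ?_
  have e (k : ℕ) : -((k : ℤ) + 1) - 1 = -(((k + 1 : ℕ) : ℤ) + 1) := by push_cast; ring
  rw [e, e]
  simp only [eisSummand]
  congr 1 <;> push_cast <;> ring

lemma conj_linear (m n : ℤ) (z : ℂ) :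
    (m : ℂ) * (starRingEnd ℂ) z + n = (starRingEnd ℂ) ((m : ℂ) * z + n) := by
  simp

lemma norm_eisSummand (r s : ℕ) (z : ℂ) (p : ℤ × ℤ) :
    ‖eisSummand r s z p‖ = (‖(p.1 : ℂ) * z + p.2‖ ^ (r + s + 2))⁻¹ := by
  have e (k : ℕ) : -((k : ℤ) + 1) = -((k + 1 : ℕ) : ℤ) := by push_cast; ring
  rw [eisSummand, conj_linear, norm_mul, norm_zpow, norm_zpow, norm_conj, e, e, zpow_neg, zpow_neg,
    zpow_natCast, zpow_natCast, ← mul_inv, ← pow_add]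
  congr 2
  ring

lemma norm_vecCons_eq_norm_prod (p : ℤ × ℤ) : ‖![p.1, p.2]‖ = ‖p‖ := by
  rw [EisensteinSeries.norm_eq_max_natAbs, Prod.norm_def]
  simp [Int.norm_eq_abs, Nat.cast_natAbs]

lemma summable_inv_norm_int_prod_pow {k : ℕ} (hk : 2 < k) :
    Summable fun p : ℤ × ℤ ↦ (‖p‖ ^ k)⁻¹ := by
  have h := EisensteinSeries.summable_one_div_norm_rpow (k := k) (by exact_mod_cast hk)
  rw [← (finTwoArrowEquiv _).symm.summable_iff] at h
  refine h.congr fun p ↦ ?_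
  simp only [Function.comp_apply, finTwoArrowEquiv_symm_apply, norm_vecCons_eq_norm_prod]
  rw [Real.rpow_neg (norm_nonneg _), Real.rpow_natCast]

/-- Near a point of the upper half plane, `‖m w + n‖` is bounded below by a uniform multiple of
`‖(m, n)‖`. -/
lemma exists_forall_mul_norm_le {z : ℂ} (hz : 0 < z.im) :
    ∃ c : ℝ, 0 < c ∧ ∀ w ∈ Metric.ball z (z.im / 2), ∀ p : ℤ × ℤ, p ≠ 0 →
      c * ‖p‖ ≤ ‖(p.1 : ℂ) * w + p.2‖ := by
  have hB : 0 < z.im / 2 := by positivity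
  refine ⟨EisensteinSeries.r ⟨⟨|z.re| + z.im / 2, z.im / 2⟩, hB⟩, EisensteinSeries.r_pos _,
    fun w hw p hp ↦ ?_⟩
  rw [Metric.mem_ball, dist_eq] at hw
  have hre := abs_le.1 ((abs_re_le_norm (w - z)).trans hw.le)
  have him := abs_le.1 ((abs_im_le_norm (w - z)).trans hw.le)
  rw [sub_re] at hre
  rw [sub_im] at him
  have hw0 : 0 < w.im := by linarith
  have hmem : (⟨w, hw0⟩ : UpperHalfPlane) ∈
      UpperHalfPlane.verticalStrip (|z.re| + z.im / 2) (z.im / 2) := by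
    rw [UpperHalfPlane.mem_verticalStrip_iff]
    refine ⟨abs_le.2 ⟨?_, ?_⟩, ?_⟩
    · change _ ≤ w.re
      linarith [neg_abs_le z.re]
    · change w.re ≤ _
      linarith [le_abs_self z.re]
    · change _ ≤ w.im
      linarith
  have hx : ![p.1, p.2] ≠ 0 := fun h ↦
    hp (Prod.ext (by simpa using congrFun h 0) (by simpa using congrFun h 1))
  have h := EisensteinSeries.r_mul_max_le ⟨w, hw0⟩ hx
  rw [norm_vecCons_eq_norm_prod] at h
  refine le_trans ?_ h
  gcongr
  exact EisensteinSeries.r_lower_bound_on_verticalStrip _ hB hmem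

lemma norm_eisSummand_le (r s : ℕ) {z : ℂ} {p : ℤ × ℤ} {c : ℝ} (hc : 0 < c) (hp : p ≠ 0)
    (h : c * ‖p‖ ≤ ‖(p.1 : ℂ) * z + p.2‖) :
    ‖eisSummand r s z p‖ ≤ (c ^ (r + s + 2))⁻¹ * (‖p‖ ^ (r + s + 2))⁻¹ := by
  have := norm_pos_iff.2 hp
  rw [norm_eisSummand, ← mul_inv, ← mul_pow]
  gcongr

lemma norm_fst_mul_eisSummand_le (r s : ℕ) {z : ℂ} {p : ℤ × ℤ} {c : ℝ} (hc : 0 < c)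
    (hp : p ≠ 0) (h : c * ‖p‖ ≤ ‖(p.1 : ℂ) * z + p.2‖) :
    ‖(p.1 : ℂ) * eisSummand r s z p‖ ≤ (c ^ (r + s + 2))⁻¹ * (‖p‖ ^ (r + s + 1))⁻¹ := by
  have hp' := norm_pos_iff.2 hp
  have h1 : ‖(p.1 : ℂ)‖ ≤ ‖p‖ := by
    rw [norm_intCast, ← Int.norm_eq_abs]
    exact norm_fst_le p
  calc ‖(p.1 : ℂ) * eisSummand r s z p‖
      ≤ ‖p‖ * ((c ^ (r + s + 2))⁻¹ * (‖p‖ ^ (r + s + 2))⁻¹) := by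
        rw [norm_mul]
        exact mul_le_mul h1 (norm_eisSummand_le r s hc hp h) (norm_nonneg _) hp'.le
    _ = (c ^ (r + s + 2))⁻¹ * (‖p‖ ^ (r + s + 1))⁻¹ := by
        field_simp
        ring

lemma summable_real_analytic_eisSummand {r s : ℕ} (hw : 0 < r + s) {z : ℂ} (hz : 0 < z.im) :
    Summable fun p : {p : ℤ × ℤ // p ≠ 0} ↦ eisSummand r s z p.1 := by
  obtain ⟨c, hc, hbound⟩ := exists_forall_mul_norm_le hz
  refine Summable.of_norm_bounded (((summable_inv_norm_int_prod_pow
    (k := r + s + 2) (by lia)).subtype _).mul_left (c ^ (r + s + 2))⁻¹) fun p ↦ ?_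
  exact norm_eisSummand_le r s hc p.2 (hbound z (Metric.mem_ball_self (by positivity)) _ p.2)

lemma summable_fst_mul_eisSummand {r s : ℕ} (hw : 1 < r + s) {z : ℂ} (hz : 0 < z.im) :
    Summable fun p : {p : ℤ × ℤ // p ≠ 0} ↦ (p.1.1 : ℂ) * eisSummand r s z p.1 := by
  obtain ⟨c, hc, hbound⟩ := exists_forall_mul_norm_le hz
  refine Summable.of_norm_bounded (((summable_inv_norm_int_prod_pow
    (k := r + s + 1) (by lia)).subtype _).mul_left (c ^ (r + s + 2))⁻¹) fun p ↦ ?_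
  exact norm_fst_mul_eisSummand_le r s hc p.2
    (hbound z (Metric.mem_ball_self (by positivity)) _ p.2)

lemma tsum_wirtingerCLM {ι : Type*} {α β : ι → ℂ} (hα : Summable α) (hβ : Summable β) :
    ∑' i, wirtingerCLM (α i) (β i) = wirtingerCLM (∑' i, α i) (∑' i, β i) := by
  simp only [wirtingerCLM]
  exact ((hα.hasSum.smul_const _).add (hβ.hasSum.smul_const _)).tsum_eq

lemma linear_ne_zero_of_mul_norm_le {w : ℂ} {p : ℤ × ℤ} {c : ℝ} (hc : 0 < c) (hp : p ≠ 0)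
    (h : c * ‖p‖ ≤ ‖(p.1 : ℂ) * w + p.2‖) : (p.1 : ℂ) * w + p.2 ≠ 0 :=
  norm_pos_iff.1 ((mul_pos hc (norm_pos_iff.2 hp)).trans_le h)

/-- The series of summands may be differentiated term by term. -/
lemma hasFDerivAt_tsum_eisSummand {r s : ℕ} (hw : 0 < r + s) {z : ℂ} (hz : 0 < z.im) :
    HasFDerivAt (fun w ↦ ∑' p : {p : ℤ × ℤ // p ≠ 0}, eisSummand r s w p.1)
      (wirtingerCLM
        (-((r : ℂ) + 1) * ∑' p : {p : ℤ × ℤ // p ≠ 0}, (p.1.1 : ℂ) * eisSummand (r + 1) s z p.1)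
        (-((s : ℂ) + 1) * ∑' p : {p : ℤ × ℤ // p ≠ 0}, (p.1.1 : ℂ) * eisSummand r (s + 1) z p.1))
      z := by
  obtain ⟨c, hc, hbound⟩ := exists_forall_mul_norm_le hz
  have hmem : z ∈ Metric.ball z (z.im / 2) := Metric.mem_ball_self (by positivity)
  have hu := ((summable_inv_norm_int_prod_pow (k := r + s + 2) (by lia)).subtype
    {p | p ≠ 0}).mul_left (((r : ℝ) + s + 2) * (c ^ (r + s + 3))⁻¹)
  have key := hasFDerivAt_tsum_of_isPreconnected hu (Metric.isOpen_ball (x := z) (ε := z.im / 2))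
    (convex_ball z (z.im / 2)).isPreconnected
    (f := fun (p : {p : ℤ × ℤ // p ≠ 0}) w ↦ eisSummand r s w p.1)
    (f' := fun p w ↦ wirtingerCLM (-((r : ℂ) + 1) * p.1.1 * eisSummand (r + 1) s w p.1)
        (-((s : ℂ) + 1) * p.1.1 * eisSummand r (s + 1) w p.1))
    (fun p w hw' ↦ ?_) (fun p w hw' ↦ ?_) hmem (summable_real_analytic_eisSummand hw hz) hmem
  · refine key.congr_fderiv ?_
    simp only [mul_assoc]
    rw [tsum_wirtingerCLM ((summable_fst_mul_eisSummand (by lia) hz).mul_left _)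
      ((summable_fst_mul_eisSummand (by lia) hz).mul_left _), tsum_mul_left, tsum_mul_left]
  · have hne := linear_ne_zero_of_mul_norm_le hc p.2 (hbound w hw' _ p.2)
    refine hasFDerivAt_eisSummand r s hne ?_
    rw [conj_linear]
    exact (map_ne_zero _).2 hne
  · have h₁ := norm_fst_mul_eisSummand_le (r + 1) s hc p.2 (hbound w hw' _ p.2)
    have h₂ := norm_fst_mul_eisSummand_le r (s + 1) hc p.2 (hbound w hw' _ p.2)
    have hn (k : ℕ) : ‖-((k : ℂ) + 1)‖ = (k : ℝ) + 1 := by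
      rw [norm_neg]
      exact_mod_cast norm_natCast (k + 1)
    rw [show r + 1 + s + 2 = r + s + 3 by ring, show r + 1 + s + 1 = r + s + 2 by ring] at h₁
    rw [show r + (s + 1) + 2 = r + s + 3 by ring, show r + (s + 1) + 1 = r + s + 2 by ring] at h₂
    refine (norm_wirtingerCLM_le _ _).trans ?_
    rw [mul_assoc, mul_assoc, norm_mul, norm_mul (-((s : ℂ) + 1)), hn, hn]
    refine (add_le_add (mul_le_mul_of_nonneg_left h₁ (by positivity))
      (mul_le_mul_of_nonneg_left h₂ (by positivity))).trans_eq ?_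
    simp only [Function.comp_apply]
    ring

lemma eisSummand_sub_eq (r s : ℕ) {z : ℂ} {p : ℤ × ℤ} (h : (p.1 : ℂ) * z + p.2 ≠ 0) :
    eisSummand r (s + 1) z p -
        (z - (starRingEnd ℂ) z) * ((p.1 : ℂ) * eisSummand (r + 1) (s + 1) z p) =
      eisSummand (r + 1) s z p := by
  have h' : (p.1 : ℂ) * (starRingEnd ℂ) z + p.2 ≠ 0 := by
    rw [conj_linear]
    exact (map_ne_zero _).2 h
  have e (k : ℕ) : -((k : ℤ) + 1) = -((k + 1 : ℕ) : ℤ) := by push_cast; ring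
  simp only [eisSummand, e, zpow_neg, zpow_natCast]
  generalize hb : (p.1 : ℂ) * (starRingEnd ℂ) z + p.2 = b at *
  generalize ha : (p.1 : ℂ) * z + p.2 = a at *
  have hab : (z - (starRingEnd ℂ) z) * (p.1 : ℂ) = a - b := by rw [← ha, ← hb]; ring
  rw [← mul_assoc, hab]
  field_simp
  ring

/-- For `r ≥ 0`, `s ≥ 1` with `w = r+s > 0` even, one has `∂_r 𝓔_{r,s} = (r+1)·𝓔_{r+1,s−1}`
on the upper half plane. -/
theorem dOp_eis (r s : ℕ) (hs : 1 ≤ s) (hw : 0 < r + s) (he : Even (r + s)) :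
    ∀ z : ℂ, 0 < z.im →
      dOp (r : ℤ) (Eis r s) z = ((r : ℂ) + 1) * Eis (r + 1) (s - 1) z := by
  intro z hz
  obtain ⟨s, rfl⟩ : ∃ t, s = t + 1 := ⟨s - 1, by lia⟩
  obtain ⟨c, hc, hbound⟩ := exists_forall_mul_norm_le hz
  have hsum : ∑' p : {p : ℤ × ℤ // p ≠ 0}, eisSummand (r + 1) s z p.1 =
      ∑' p : {p : ℤ × ℤ // p ≠ 0}, eisSummand r (s + 1) z p.1 - (z - (starRingEnd ℂ) z) *
        ∑' p : {p : ℤ × ℤ // p ≠ 0}, (p.1.1 : ℂ) * eisSummand (r + 1) (s + 1) z p.1 := by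
    rw [← tsum_mul_left, ← (summable_real_analytic_eisSummand hw hz).tsum_sub
      ((summable_fst_mul_eisSummand (r := r + 1) (s := s + 1) (by lia) hz).mul_left _)]
    refine tsum_congr fun p ↦ (eisSummand_sub_eq r s ?_).symm
    exact linear_ne_zero_of_mul_norm_le hc p.2
      (hbound z (Metric.mem_ball_self (by positivity)) _ p.2)
  have hE := ((hasFDerivAt_Lfun z).mul_wirtingerCLM (hasFDerivAt_tsum_eisSummand hw hz)).const_mul
    (((r + (s + 1)).factorial : ℂ) / (2 * (Real.pi : ℂ) * I) ^ (r + (s + 1) + 2) * (1 / 2))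
  rw [smul_wirtingerCLM] at hE
  have hEis : HasFDerivAt (Eis r (s + 1)) (wirtingerCLM _ _) z :=
    hE.congr_of_eventuallyEq (Filter.Eventually.of_forall fun w ↦ mul_assoc _ _ _)
  rw [dOp, hEis.wderiv_eq, Eis, Eis, Nat.add_sub_cancel, hsum, show r + 1 + s = r + (s + 1) by ring,
    Lfun]
  push_cast
  ring
end

section
/- Let α, β be integers, w = α + β, and s ∈ ℂ. Let f : ℍ → ℂ be continuously differentiable. Assume that the three functions y ↦ f(iy)·y^{s−1}, y ↦ (∂_α f)(iy)·y^{s−1} and y ↦ (∂̄_β f)(iy)·y^{s−1} are absolutely integrable on (0,∞) (where y^{s} = exp(s·log y)), and that f(iy)·y^{s} → 0 both as y → 0⁺ and as y → ∞. Define Λ(g; s) = ∫_0^∞ g(iy)·y^{s−1} dy for each of these integrands. Then Λ(∂_α f; s) + Λ(∂̄_β f; s) + (2s − w)·Λ(f; s) = 0. -/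
open Complex MeasureTheory

/-- The anti-holomorphic Wirtinger derivative `∂/∂z̄ = ½(∂/∂x + i ∂/∂y)`. -/
noncomputable def wderivBar (f : ℂ → ℂ) (z : ℂ) : ℂ :=
  (1 / 2) * (fderiv ℝ f z 1 + Complex.I * fderiv ℝ f z Complex.I)

/-- The Maass-type lowering operator `(∂̄_s f)(z) = (z̄ − z)·(∂f/∂z̄)(z) + s·f(z)`. -/
noncomputable def dBarOp (s : ℤ) (f : ℂ → ℂ) (z : ℂ) : ℂ :=
  ((starRingEnd ℂ) z - z) * wderivBar f z + (s : ℂ) * f z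

/-- On the imaginary axis, `∂_α f + ∂̄_β f` is `2 y d/dy + (α + β)`. -/
lemma dOp_add_dBarOp_mul_I (α β : ℤ) (f : ℂ → ℂ) (y : ℝ) :
    dOp α f (y * I) + dBarOp β f (y * I) =
      2 * y * fderiv ℝ f (y * I) I + ((α + β : ℤ) : ℂ) * f (y * I) := by
  simp only [dOp, dBarOp, wderiv, wderivBar, map_mul, conj_ofReal, conj_I]
  push_cast
  linear_combination (-2 * y * fderiv ℝ f (y * I) I) * I_sq

lemma hasDerivAt_ofReal_cpow_of_pos (s : ℂ) {y : ℝ} (hy : 0 < y) :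
    HasDerivAt (fun t : ℝ => (t : ℂ) ^ s) (s * (y : ℂ) ^ (s - 1)) y := by
  simpa using ((hasDerivAt_id (y : ℂ)).cpow_const (c := s)
    (ofReal_mem_slitPlane.2 hy)).comp_ofReal

lemma hasDerivAt_comp_ofReal_mul_I {f : ℂ → ℂ} {y : ℝ}
    (hf : DifferentiableAt ℝ f (y * I)) :
    HasDerivAt (fun t : ℝ => f (t * I)) (fderiv ℝ f (y * I) I) y := by
  have hline : HasDerivAt (fun t : ℝ => (t : ℂ) * I) I y := by
    simpa using (hasDerivAt_id y).ofReal_comp.mul_const I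
  exact hf.hasFDerivAt.comp_hasDerivAt y hline

/-- Compatibility of the Mellin transform `Λ(g;s) = ∫_0^∞ g(iy) y^{s−1} dy` with the
differential operators: `Λ(∂_α f; s) + Λ(∂̄_β f; s) + (2s − w)·Λ(f; s) = 0`, `w = α+β`. -/
theorem lambda_differential_relation (α β : ℤ) (s : ℂ) (f : ℂ → ℂ)
    (hf : ContDiffOn ℝ 1 f {z : ℂ | 0 < z.im})
    (hint : IntegrableOn (fun y : ℝ => f ((y : ℂ) * Complex.I) * (y : ℂ) ^ (s - 1))
      (Set.Ioi 0))
    (hint1 : IntegrableOn (fun y : ℝ => dOp α f ((y : ℂ) * Complex.I) * (y : ℂ) ^ (s - 1))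
      (Set.Ioi 0))
    (hint2 : IntegrableOn (fun y : ℝ => dBarOp β f ((y : ℂ) * Complex.I) * (y : ℂ) ^ (s - 1))
      (Set.Ioi 0))
    (h0 : Filter.Tendsto (fun y : ℝ => f ((y : ℂ) * Complex.I) * (y : ℂ) ^ s)
      (nhdsWithin 0 (Set.Ioi 0)) (nhds 0))
    (hInf : Filter.Tendsto (fun y : ℝ => f ((y : ℂ) * Complex.I) * (y : ℂ) ^ s)
      Filter.atTop (nhds 0)) :
    (∫ y in Set.Ioi (0 : ℝ), dOp α f ((y : ℂ) * Complex.I) * (y : ℂ) ^ (s - 1))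
      + (∫ y in Set.Ioi (0 : ℝ), dBarOp β f ((y : ℂ) * Complex.I) * (y : ℂ) ^ (s - 1))
      + (2 * s - ((α + β : ℤ) : ℂ)) *
          ∫ y in Set.Ioi (0 : ℝ), f ((y : ℂ) * Complex.I) * (y : ℂ) ^ (s - 1) = 0 := by
  have hcombine : ∀ y ∈ Set.Ioi (0 : ℝ),
      2⁻¹ * (dOp α f (y * I) * (y : ℂ) ^ (s - 1) + dBarOp β f (y * I) * (y : ℂ) ^ (s - 1)
        + (2 * s - ((α + β : ℤ) : ℂ)) * (f (y * I) * (y : ℂ) ^ (s - 1))) =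
      fderiv ℝ f (y * I) I * (y : ℂ) ^ s + f (y * I) * (s * (y : ℂ) ^ (s - 1)) := by
    intro y hy
    have hpow : (y : ℂ) ^ s = (y : ℂ) ^ (s - 1) * y := by
      have hy0 : (y : ℂ) ≠ 0 := ofReal_ne_zero.2 (ne_of_gt hy)
      rw [cpow_sub _ _ hy0, cpow_one, div_mul_cancel₀ _ hy0]
    linear_combination 2⁻¹ * (y : ℂ) ^ (s - 1) * dOp_add_dBarOp_mul_I α β f y
      - fderiv ℝ f (y * I) I * hpow
  have hdiff : ∀ y ∈ Set.Ioi (0 : ℝ), DifferentiableAt ℝ f (y * I) := fun y hy =>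
    (hf.differentiableOn one_ne_zero).differentiableAt
      ((isOpen_lt continuous_const continuous_im).mem_nhds (by simpa using hy))
  have hint12 : IntegrableOn (fun y : ℝ => dOp α f (y * I) * (y : ℂ) ^ (s - 1)
      + dBarOp β f (y * I) * (y : ℂ) ^ (s - 1)) (Set.Ioi 0) := hint1.add hint2
  have hsum := hint12.add (hint.const_mul (2 * s - ((α + β : ℤ) : ℂ)))
  have hftc := integral_Ioi_deriv_mul_eq_sub
    (fun y hy => hasDerivAt_comp_ofReal_mul_I (hdiff y hy))
    (fun y hy => hasDerivAt_ofReal_cpow_of_pos s hy)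
    (IntegrableOn.congr_fun (hsum.const_mul 2⁻¹) hcombine measurableSet_Ioi) h0 hInf
  rw [← setIntegral_congr_fun measurableSet_Ioi hcombine, integral_const_mul,
    integral_add hint12 (hint.const_mul _), integral_add hint1 hint2,
    integral_const_mul, sub_zero] at hftc
  simpa using hftc
end

section
/- Let α, β be integers, w = α + β, and s ∈ ℂ. Let f : ℍ → ℂ be continuous and satisfy the inversion law f(−1/z) = z^{α}·z̄^{β}·f(z) for all z ∈ ℍ. Assume that the functions y ↦ f(iy)·y^{s−1} and y ↦ f(iy)·y^{w−s−1} are absolutely integrable on (0,∞). Then the completed L-function satisfies the functional equation ∫_0^∞ f(iy)·y^{s−1} dy = i^{α−β}·∫_0^∞ f(iy)·y^{w−s−1} dy; that is, Λ(f; s) = i^{h}·Λ(f; w−s) with h = α − β. -/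
open Complex MeasureTheory

/-- The inversion law of weights `(α, β)` restricted to the imaginary axis. -/
lemma inversion_law_imaginary_axis {α β : ℤ} {f : ℂ → ℂ}
    (hinv : ∀ z : ℂ, 0 < z.im →
      f (-1 / z) = z ^ α * ((starRingEnd ℂ) z) ^ β * f z) {y : ℝ} (hy : 0 < y) :
    f (((y⁻¹ : ℝ) : ℂ) * I) = I ^ (α - β) * ((y : ℂ) ^ ((α + β : ℤ) : ℂ) * f ((y : ℂ) * I)) := by
  have hy0 : (y : ℂ) ≠ 0 := ofReal_ne_zero.mpr hy.ne'
  have hz : -1 / ((y : ℂ) * I) = ((y⁻¹ : ℝ) : ℂ) * I := by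
    rw [div_eq_iff (mul_ne_zero hy0 I_ne_zero), ofReal_inv, mul_mul_mul_comm,
      inv_mul_cancel₀ hy0, I_mul_I, one_mul]
  have hI : (starRingEnd ℂ) ((y : ℂ) * I) = y * I⁻¹ := by
    rw [map_mul, conj_ofReal, conj_I, inv_I]
  rw [← hz, hinv _ (by simpa using hy), hI, cpow_intCast, zpow_add₀ hy0, sub_eq_add_neg,
    zpow_add₀ I_ne_zero, mul_zpow, mul_zpow, inv_zpow']
  ring

/-- For `f` continuous on `ℍ` satisfying the inversion law
`f(−1/z) = z^α z̄^β f(z)`, the completed `L`-function `Λ(f;s) = ∫_0^∞ f(iy) y^{s−1} dy`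
satisfies the functional equation `Λ(f; s) = i^{α−β}·Λ(f; w−s)` with `w = α+β`. -/
theorem lambda_functional_equation (α β : ℤ) (s : ℂ) (f : ℂ → ℂ)
    (hf : ContinuousOn f {z : ℂ | 0 < z.im})
    (hinv : ∀ z : ℂ, 0 < z.im →
      f (-1 / z) = z ^ α * ((starRingEnd ℂ) z) ^ β * f z)
    (hint1 : IntegrableOn (fun y : ℝ => f ((y : ℂ) * Complex.I) * (y : ℂ) ^ (s - 1))
      (Set.Ioi 0))
    (hint2 : IntegrableOn
      (fun y : ℝ => f ((y : ℂ) * Complex.I) * (y : ℂ) ^ (((α + β : ℤ) : ℂ) - s - 1))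
      (Set.Ioi 0)) :
    (∫ y in Set.Ioi (0 : ℝ), f ((y : ℂ) * Complex.I) * (y : ℂ) ^ (s - 1))
      = Complex.I ^ (α - β) *
          ∫ y in Set.Ioi (0 : ℝ),
            f ((y : ℂ) * Complex.I) * (y : ℂ) ^ (((α + β : ℤ) : ℂ) - s - 1) := by
  have hmellin (t : ℂ) : (∫ y in Set.Ioi (0 : ℝ), f ((y : ℂ) * I) * (y : ℂ) ^ (t - 1))
      = mellin (fun y : ℝ => f ((y : ℂ) * I)) t := by
    simp only [mellin, smul_eq_mul, mul_comm]
  rw [hmellin, ← neg_neg s, ← mellin_comp_inv, neg_neg, mellin, ← integral_const_mul]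
  refine setIntegral_congr_fun measurableSet_Ioi fun y hy => ?_
  have hy0 : (y : ℂ) ≠ 0 := ofReal_ne_zero.mpr (ne_of_gt hy)
  have hexp : ((α + β : ℤ) : ℂ) - s - 1 = ((α + β : ℤ) : ℂ) + (-s - 1) := by ring
  simp only [smul_eq_mul]
  rw [inversion_law_imaginary_axis hinv hy, hexp, cpow_add _ _ hy0]
  ring
end
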